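/- Let f : [0,∞) → [0,∞) be a concave function, let A be a positive semidefinite n×n complex matrix, and let Z be an expansive n×n complex matrix (i.e. Z*Z ≥ I). Then Tr f(Z*AZ) ≤ Tr Z*f(A)Z. -/

import Mathlib

open Matrix ComplexOrder

/-- `f(A)` for a Hermitian matrix `A`: apply `f` to the eigenvalues in a spectral
decomposition of `A`. -/
noncomputable def matFn {n : ℕ} (f : ℝ → ℝ) (A : Matrix (Fin n) (Fin n) ℂ)
    (hA : A.IsHermitian) : Matrix (Fin n) (Fin n) ℂ :=
  (hA.eigenvectorUnitary : Matrix (Fin n) (Fin n) ℂ) *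
    Matrix.diagonal (fun i => (f (hA.eigenvalues i) : ℂ)) *
    (star hA.eigenvectorUnitary : Matrix (Fin n) (Fin n) ℂ)

theorem matFn_isHermitian {n : ℕ} (f : ℝ → ℝ) (A : Matrix (Fin n) (Fin n) ℂ)
    (hA : A.IsHermitian) : (matFn f A hA).IsHermitian := by
  have h1 : (Matrix.diagonal (fun i => (f (hA.eigenvalues i) : ℂ))).IsHermitian :=
    Matrix.isHermitian_diagonal_of_self_adjoint _ (by ext i; simp [Pi.star_def])
  have h2 := Matrix.isHermitian_mul_mul_conjTranspose
    (hA.eigenvectorUnitary : Matrix (Fin n) (Fin n) ℂ) h1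
  simpa [matFn, Matrix.star_eq_conjTranspose] using h2

/-- The sum of the `k` largest entries of `μ` (for the eigenvalue vector of a Hermitian
matrix, this is the Ky Fan `k`-sum of its eigenvalues). -/
noncomputable def sumKLargest {n : ℕ} (μ : Fin n → ℝ) (k : ℕ) : ℝ :=
  (((List.ofFn μ).insertionSort (· ≥ ·)).take k).sum

theorem isHermitian_sum_conj {n m : ℕ} (A Z : Fin m → Matrix (Fin n) (Fin n) ℂ)
    (hA : ∀ i, (A i).IsHermitian) : (∑ i, (Z i)ᴴ * A i * Z i).IsHermitian := by
  rw [Matrix.IsHermitian, Matrix.conjTranspose_sum]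
  exact Finset.sum_congr rfl fun i _ =>
    Matrix.isHermitian_conjTranspose_mul_mul (Z i) (hA i)

section Concave

variable {f : ℝ → ℝ}

theorem ConcaveOn.secant_three_points {s : Set ℝ} (hf : ConcaveOn ℝ s f) {x y z : ℝ}
    (hx : x ∈ s) (hz : z ∈ s) (hxy : x < y) (hyz : y < z) :
    (z - y) * f x + (y - x) * f z ≤ (z - x) * f y := by
  have h := hf.neg.secant_mono_aux1 hx hz hxy hyz
  simp only [Pi.neg_apply] at h
  linarith

/-- A nonnegative concave function on `[0,∞)` is monotone. -/
theorem ConcaveOn.monotoneOn_of_nonneg (hf : ConcaveOn ℝ (Set.Ici 0) f)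
    (hf0 : ∀ x ∈ Set.Ici (0 : ℝ), 0 ≤ f x) : MonotoneOn f (Set.Ici 0) := by
  intro x hx y hy hxy
  rcases hxy.eq_or_lt with rfl | hlt
  · exact le_rfl
  by_contra! h
  have hm : 0 < f x - f y := by linarith
  have hd : 0 < y - x := by linarith
  have hyz : 0 < (y - x) * (f y + 1) / (f x - f y) := by
    have := hf0 y hy
    positivity
  set d := (y - x) * (f y + 1) / (f x - f y) with hd_def
  have hdm : d * (f x - f y) = (y - x) * (f y + 1) := by
    rw [hd_def]; field_simp
  have hz : y + d ∈ Set.Ici (0 : ℝ) := by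
    simp only [Set.mem_Ici] at *; linarith
  have h3 := hf.secant_three_points hx hz hlt (by linarith : y < y + d)
  nlinarith [mul_nonneg hd.le (hf0 _ hz)]

/-- Relative to finitely many test points, a nonnegative concave function on `[0,∞)` has
nonnegative decreasing supergradients, also at a possible discontinuity at `0`. -/
theorem ConcaveOn.exists_antitoneOn_supergradient (hf : ConcaveOn ℝ (Set.Ici 0) f)
    (hf0 : ∀ x ∈ Set.Ici (0 : ℝ), 0 ≤ f x) {ι : Type*} [Finite ι] (l : ι → ℝ)
    (hl : ∀ k, 0 ≤ l k) :
    ∃ s : ℝ → ℝ, AntitoneOn s (Set.Ici 0) ∧ (∀ a, 0 ≤ a → s a * a ≤ f a) ∧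
      ∀ a, 0 ≤ a → ∀ k, f (l k) ≤ f a + s a * (l k - a) := by
  have hmono := hf.monotoneOn_of_nonneg hf0
  let t : ℝ → ι → ℝ := fun a k => if a < l k then (f (l k) - f a) / (l k - a) else 0
  have ht0 : ∀ a, 0 ≤ a → ∀ k, 0 ≤ t a k := by
    intro a ha k
    simp only [t]
    split_ifs with h
    · exact div_nonneg (sub_nonneg.2 (hmono ha (hl k) h.le)) (sub_nonneg.2 h.le)
    · exact le_rfl
  have hle : ∀ a k, t a k ≤ ⨆ k, t a k := fun a k =>
    le_ciSup (Set.finite_range (t a)).bddAbove k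
  have hs0 : ∀ a, 0 ≤ a → 0 ≤ ⨆ k, t a k := fun a ha => Real.iSup_nonneg (ht0 a ha)
  refine ⟨fun a => ⨆ k, t a k, ?_, ?_, ?_⟩
  · intro a ha b hb hab
    refine Real.iSup_le (fun k => ?_) (hs0 a ha)
    rcases hab.eq_or_lt with rfl | hab
    · exact hle _ k
    by_cases h : b < l k
    · refine le_trans ?_ (hle a k)
      simp only [t, if_pos h, if_pos (hab.trans h)]
      have h3 := hf.secant_three_points ha (hl k) hab h
      rw [div_le_div_iff₀ (by linarith) (by linarith)]
      linarith
    · simpa only [t, if_neg h] using hs0 a ha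
  · intro a ha
    rcases ha.eq_or_lt with rfl | hpos
    · simpa using hf0 0 (by simp)
    rw [← le_div_iff₀ hpos]
    refine Real.iSup_le (fun k => ?_) (div_nonneg (hf0 a ha) ha)
    by_cases h : a < l k
    · simp only [t, if_pos h]
      have h3 := hf.secant_three_points (by simp : (0 : ℝ) ∈ Set.Ici 0) (hl k) hpos h
      have := mul_nonneg (sub_nonneg.2 h.le) (hf0 0 (by simp))
      rw [div_le_div_iff₀ (by linarith) hpos]
      linarith
    · simpa only [t, if_neg h] using div_nonneg (hf0 a ha) ha
  · intro a ha k
    rcases lt_trichotomy a (l k) with h | h | h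
    · have h1 := hle a k
      simp only [t, if_pos h] at h1
      rw [div_le_iff₀ (by linarith)] at h1
      linarith
    · simp [← h]
    · have hs : (⨆ k, t a k) ≤ (f a - f (l k)) / (a - l k) := by
        have h0 : 0 ≤ (f a - f (l k)) / (a - l k) :=
          div_nonneg (sub_nonneg.2 (hmono (hl k) ha h.le)) (sub_nonneg.2 h.le)
        refine Real.iSup_le (fun j => ?_) h0
        by_cases hj : a < l j
        · simp only [t, if_pos hj]
          exact hf.slope_anti_adjacent (hl k) (hl j) h hj
        · simpa only [t, if_neg hj] using h0
      rw [le_div_iff₀ (by linarith)] at hs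
      linarith

/-- The scalar inequality behind the trace inequality: `p` is doubly stochastic and `w` is
triangular with respect to the order of the values `a`, with row sums at least one. -/
theorem ConcaveOn.sum_le_sum_mul_of_triangular {ι κ : Type*} [Fintype ι] [Fintype κ]
    (hf : ConcaveOn ℝ (Set.Ici 0) f) (hf0 : ∀ x ∈ Set.Ici (0 : ℝ), 0 ≤ f x)
    (l : κ → ℝ) (hl : ∀ k, 0 ≤ l k) (a : ι → ℝ) (ha : ∀ i, 0 ≤ a i)
    (p : ι → κ → ℝ) (hp : ∀ j k, 0 ≤ p j k) (hp_row : ∀ j, ∑ k, p j k = 1)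
    (hp_col : ∀ k, ∑ j, p j k = 1) (w : ι → ι → ℝ) (hw : ∀ i j, 0 ≤ w i j)
    (hw_row : ∀ i, 1 ≤ ∑ j, w i j) (hw_tri : ∀ i j, a j < a i → w i j = 0)
    (hpw : ∀ j, ∑ k, p j k * l k = ∑ i, w i j * a i) :
    ∑ k, f (l k) ≤ ∑ i, (∑ j, w i j) * f (a i) := by
  obtain ⟨s, hs, hsf, hsup⟩ := hf.exists_antitoneOn_supergradient hf0 l hl
  have h1 : ∀ j, ∑ k, p j k * f (l k) ≤ f (a j) - s (a j) * a j + s (a j) * ∑ i, w i j * a i := by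
    intro j
    calc ∑ k, p j k * f (l k)
        ≤ ∑ k, p j k * (f (a j) + s (a j) * (l k - a j)) :=
          Finset.sum_le_sum fun k _ => mul_le_mul_of_nonneg_left (hsup _ (ha j) k) (hp j k)
      _ = (∑ k, p j k) * (f (a j) - s (a j) * a j) + s (a j) * ∑ k, p j k * l k := by
          rw [Finset.sum_mul, Finset.mul_sum, ← Finset.sum_add_distrib]
          exact Finset.sum_congr rfl fun k _ => by ring
      _ = _ := by rw [hp_row, hpw, one_mul]
  have h2 : ∀ i j, s (a j) * (w i j * a i) ≤ w i j * (s (a i) * a i) := by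
    intro i j
    rcases lt_or_ge (a j) (a i) with h | h
    · simp [hw_tri i j h]
    · nlinarith [mul_le_mul_of_nonneg_right (hs (ha i) (ha j) h) (mul_nonneg (hw i j) (ha i))]
  calc ∑ k, f (l k) = ∑ k, (∑ j, p j k) * f (l k) := by simp [hp_col]
    _ = ∑ j, ∑ k, p j k * f (l k) := by
        simp_rw [Finset.sum_mul]
        exact Finset.sum_comm
    _ ≤ ∑ j, (f (a j) - s (a j) * a j + s (a j) * ∑ i, w i j * a i) :=
        Finset.sum_le_sum fun j _ => h1 j
    _ = ∑ i, (f (a i) - s (a i) * a i) + ∑ i, ∑ j, s (a j) * (w i j * a i) := by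
        rw [Finset.sum_add_distrib, Finset.sum_comm (γ := ι)]
        simp_rw [Finset.mul_sum]
    _ ≤ ∑ i, (f (a i) - s (a i) * a i) + ∑ i, ∑ j, w i j * (s (a i) * a i) := by
        exact add_le_add le_rfl (Finset.sum_le_sum fun i _ => Finset.sum_le_sum fun j _ => h2 i j)
    _ = ∑ i, ((f (a i) - s (a i) * a i) + (∑ j, w i j) * (s (a i) * a i)) := by
        rw [Finset.sum_add_distrib]
        simp_rw [Finset.sum_mul]
    _ ≤ ∑ i, (∑ j, w i j) * f (a i) := by
        refine Finset.sum_le_sum fun i _ => ?_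
        nlinarith [mul_nonneg (sub_nonneg.2 (hw_row i)) (sub_nonneg.2 (hsf _ (ha i)))]

end Concave

namespace Matrix

/-- A variant of the QR decomposition: the columns of any square matrix can be rotated so that the
result is triangular with respect to a prescribed ordering of the indices. -/
theorem exists_unitary_mul_triangular {n : ℕ} (M : Matrix (Fin n) (Fin n) ℂ) (a : Fin n → ℝ) :
    ∃ B ∈ unitaryGroup (Fin n) ℂ, ∀ i j, a j < a i → (M * B) i j = 0 := by
  obtain ⟨σ, hσ⟩ : ∃ σ : Equiv.Perm (Fin n), Monotone fun i => -a (σ i) :=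
    ⟨Tuple.sort fun i => -a i, Tuple.monotone_sort fun i => -a i⟩
  obtain ⟨b, hb⟩ : ∃ b : OrthonormalBasis (Fin n) ℂ (EuclideanSpace ℂ (Fin n)),
      ∀ i j, i < j → inner ℂ (b j) (WithLp.toLp 2 (star (M (σ i)))) = 0 :=
    ⟨InnerProductSpace.gramSchmidtOrthonormalBasis finrank_euclideanSpace
      fun i => WithLp.toLp 2 (star (M (σ i))), fun _ _ h =>
      InnerProductSpace.gramSchmidtOrthonormalBasis_inv_triangular finrank_euclideanSpace _ h⟩
  refine ⟨(EuclideanSpace.basisFun (Fin n) ℂ).toBasis.toMatrix (b.reindex σ),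
    OrthonormalBasis.toMatrix_orthonormalBasis_mem_unitary _ _, fun i j hij => ?_⟩
  have hlt : σ.symm i < σ.symm j := by
    by_contra! h
    have := hσ h
    simp only [Equiv.apply_symm_apply] at this
    linarith
  have h := inner_eq_zero_symm.1 (hb _ _ hlt)
  rw [mul_apply, ← h]
  simp [PiLp.inner_apply, Module.Basis.toMatrix_apply, mul_comm]

theorem PosSemidef.mul_conjTranspose_sub_one {n : Type*} [Fintype n] [DecidableEq n]
    {Z : Matrix n n ℂ} (hZ : (Zᴴ * Z - 1).PosSemidef) : (Z * Zᴴ - 1).PosSemidef := by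
  have hpd : (Zᴴ * Z).PosDef := by simpa using PosDef.posSemidef_add hZ PosDef.one
  have hu : IsUnit Z := isUnit_of_mul_isUnit_right hpd.isUnit
  have hdet := (isUnit_iff_isUnit_det Z).1 hu
  have hr : Z * Z⁻¹ = 1 := mul_nonsing_inv Z hdet
  have hl : Z⁻¹ᴴ * Zᴴ = 1 := by rw [← conjTranspose_mul, hr, conjTranspose_one]
  have hsq : ((Zᴴ * Z - 1) * (Zᴴ * Z - 1)).PosSemidef := by
    have := posSemidef_conjTranspose_mul_self (Zᴴ * Z - 1)
    rwa [hZ.1.eq] at this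
  have h := (hsq.add hZ).conjTranspose_mul_mul_same Z⁻¹
  have e : (Zᴴ * Z - 1) * (Zᴴ * Z - 1) + (Zᴴ * Z - 1) = Zᴴ * (Z * Zᴴ - 1) * Z := by
    noncomm_ring
  have e2 : Z⁻¹ᴴ * (Zᴴ * (Z * Zᴴ - 1) * Z) * Z⁻¹ =
      (Z⁻¹ᴴ * Zᴴ) * (Z * Zᴴ - 1) * (Z * Z⁻¹) := by noncomm_ring
  rwa [e, e2, hl, hr, one_mul, mul_one] at h

theorem mul_conjTranspose_apply_self {m n : Type*} [Fintype n] (N : Matrix m n ℂ) (i : m) :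
    (N * Nᴴ) i i = ((∑ j, Complex.normSq (N i j) : ℝ) : ℂ) := by
  simp [mul_apply, Complex.mul_conj]

theorem mul_diagonal_mul_conjTranspose_apply_self {m n : Type*} [Fintype n] [DecidableEq n]
    (N : Matrix m n ℂ) (d : n → ℝ) (i : m) :
    (N * diagonal (fun k => (d k : ℂ)) * Nᴴ) i i =
      ((∑ k, Complex.normSq (N i k) * d k : ℝ) : ℂ) := by
  rw [mul_apply]
  push_cast
  refine Finset.sum_congr rfl fun k _ => ?_
  rw [mul_diagonal, conjTranspose_apply, Complex.normSq_eq_conj_mul_self, RCLike.star_def]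
  ring

end Matrix

theorem matFn_id {n : ℕ} (A : Matrix (Fin n) (Fin n) ℂ) (hA : A.IsHermitian) :
    matFn (fun x => x) A hA = A := by
  conv_rhs => rw [hA.spectral_theorem, Unitary.conjStarAlgAut_apply]
  rfl

theorem trace_matFn {n : ℕ} (f : ℝ → ℝ) (A : Matrix (Fin n) (Fin n) ℂ) (hA : A.IsHermitian) :
    (matFn f A hA).trace = ((∑ i, f (hA.eigenvalues i) : ℝ) : ℂ) := by
  rw [matFn, trace_mul_comm, ← mul_assoc]
  simp [trace_diagonal]

/-- Reversed Brown–Kosaki inequality for expansive congruences: for a non-negative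
concave function `f` on `[0,∞)`, a positive semidefinite `A` and an expansive `Z`
(`Z*Z ≥ I`), `Tr f(Z* A Z) ≤ Tr Z* f(A) Z`. -/
theorem trace_concave_expansive_congruence {n : ℕ} (f : ℝ → ℝ)
    (hf : ConcaveOn ℝ (Set.Ici 0) f) (hf0 : ∀ x ∈ Set.Ici (0 : ℝ), 0 ≤ f x)
    (A Z : Matrix (Fin n) (Fin n) ℂ) (hA : A.PosSemidef)
    (hZ : (Zᴴ * Z - 1).PosSemidef) :
    (matFn f _ (Matrix.isHermitian_conjTranspose_mul_mul Z hA.1)).trace ≤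
    (Zᴴ * matFn f A hA.1 * Z).trace := by
  have hX := isHermitian_conjTranspose_mul_mul Z hA.1
  have hXpsd : (Zᴴ * A * Z).PosSemidef := hA.conjTranspose_mul_mul_same Z
  obtain ⟨U, hUdef⟩ : ∃ U : Matrix (Fin n) (Fin n) ℂ, U = hA.1.eigenvectorUnitary := ⟨_, rfl⟩
  obtain ⟨V, hVdef⟩ : ∃ V : Matrix (Fin n) (Fin n) ℂ, V = hX.eigenvectorUnitary := ⟨_, rfl⟩
  have hU : Uᴴ * U = 1 := by rw [hUdef]; exact Unitary.coe_star_mul_self _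
  have hV : Vᴴ * V = 1 := by rw [hVdef]; exact Unitary.coe_star_mul_self _
  have hV' : V * Vᴴ = 1 := mul_eq_one_comm.1 hV
  have hfun : ∀ g : ℝ → ℝ, matFn g A hA.1 =
      U * diagonal (fun i => (g (hA.1.eigenvalues i) : ℂ)) * Uᴴ := fun g => by rw [hUdef]; rfl
  have hfunX : ∀ g : ℝ → ℝ, matFn g _ hX =
      V * diagonal (fun i => (g (hX.eigenvalues i) : ℂ)) * Vᴴ := fun g => by rw [hVdef]; rfl
  obtain ⟨B, hB, htri⟩ := exists_unitary_mul_triangular (Uᴴ * Z) hA.1.eigenvalues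
  have hB1 : Bᴴ * B = 1 := mem_unitaryGroup_iff'.1 hB
  have hB2 : B * Bᴴ = 1 := mul_eq_one_comm.1 hB1
  obtain ⟨N, hN⟩ : ∃ N, N = Uᴴ * Z * B := ⟨_, rfl⟩
  rw [← hN] at htri
  have hNN : N * Nᴴ = Uᴴ * (Z * Zᴴ) * U := by
    calc N * Nᴴ = Uᴴ * Z * (B * Bᴴ) * Zᴴ * U := by
          simp only [hN, conjTranspose_mul, conjTranspose_conjTranspose, Matrix.mul_assoc]
      _ = _ := by simp only [hB2, Matrix.mul_one, Matrix.mul_assoc]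
  have hrow : ∀ i, 1 ≤ ∑ j, Complex.normSq (N i j) := by
    intro i
    have h := (hZ.mul_conjTranspose_sub_one.conjTranspose_mul_mul_same U).diag_nonneg (i := i)
    have e : Uᴴ * (Z * Zᴴ - 1) * U = N * Nᴴ - 1 := by
      rw [hNN, Matrix.mul_sub, Matrix.sub_mul, Matrix.mul_one, hU]
    rw [e, Matrix.sub_apply, mul_conjTranspose_apply_self, one_apply_eq, sub_nonneg] at h
    exact_mod_cast h
  obtain ⟨P, hP⟩ : ∃ P, P = Bᴴ * V := ⟨_, rfl⟩
  have hP1 : P * Pᴴ = 1 := by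
    calc P * Pᴴ = Bᴴ * (V * Vᴴ) * B := by
          simp only [hP, conjTranspose_mul, conjTranspose_conjTranspose, Matrix.mul_assoc]
      _ = 1 := by rw [hV', Matrix.mul_one, hB1]
  have hP2 : Pᴴ * Pᴴᴴ = 1 := by rw [conjTranspose_conjTranspose]; exact mul_eq_one_comm.1 hP1
  have hprow : ∀ j, ∑ k, Complex.normSq (P j k) = 1 := by
    intro j
    have h := mul_conjTranspose_apply_self P j
    rw [hP1, one_apply_eq] at h
    exact_mod_cast h.symm
  have hpcol : ∀ k, ∑ j, Complex.normSq (P j k) = 1 := by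
    intro k
    have h := mul_conjTranspose_apply_self Pᴴ k
    rw [hP2, one_apply_eq] at h
    simpa using (Complex.ofReal_injective (by simpa using h.symm) :
      ∑ j, Complex.normSq (Pᴴ k j) = 1)
  have hpw : ∀ j, ∑ k, Complex.normSq (P j k) * hX.eigenvalues k =
      ∑ i, Complex.normSq (N i j) * hA.1.eigenvalues i := by
    intro j
    have e1 : P * diagonal (fun k => (hX.eigenvalues k : ℂ)) * Pᴴ = Bᴴ * (Zᴴ * A * Z) * B := by
      conv_rhs => rw [← matFn_id _ hX, hfunX]
      simp only [hP, conjTranspose_mul, conjTranspose_conjTranspose, Matrix.mul_assoc]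
    have e2 : Nᴴ * diagonal (fun k => (hA.1.eigenvalues k : ℂ)) * Nᴴᴴ =
        Bᴴ * (Zᴴ * A * Z) * B := by
      conv_rhs => rw [← matFn_id _ hA.1, hfun]
      simp only [hN, conjTranspose_mul, conjTranspose_conjTranspose, Matrix.mul_assoc]
    have h1 := mul_diagonal_mul_conjTranspose_apply_self P hX.eigenvalues j
    have h2 := mul_diagonal_mul_conjTranspose_apply_self Nᴴ hA.1.eigenvalues j
    rw [e1] at h1
    rw [e2, h1] at h2
    simpa using Complex.ofReal_injective h2
  have hR : (Zᴴ * matFn f A hA.1 * Z).trace =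
      ((∑ i, (∑ j, Complex.normSq (N i j)) * f (hA.1.eigenvalues i) : ℝ) : ℂ) := by
    calc (Zᴴ * matFn f A hA.1 * Z).trace
        = ((Zᴴ * U) * (diagonal (fun i => (f (hA.1.eigenvalues i) : ℂ)) * Uᴴ * Z)).trace := by
          simp only [hfun, Matrix.mul_assoc]
      _ = (diagonal (fun i => (f (hA.1.eigenvalues i) : ℂ)) * (N * Nᴴ)).trace := by
          rw [trace_mul_comm, hNN]
          simp only [Matrix.mul_assoc]
      _ = _ := by
          simp only [trace, diag_apply, diagonal_mul, mul_conjTranspose_apply_self]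
          push_cast
          exact Finset.sum_congr rfl fun i _ => mul_comm _ _
  rw [hR, trace_matFn]
  exact_mod_cast hf.sum_le_sum_mul_of_triangular hf0 hX.eigenvalues hXpsd.eigenvalues_nonneg
    hA.1.eigenvalues hA.eigenvalues_nonneg (fun j k => Complex.normSq (P j k))
    (fun _ _ => Complex.normSq_nonneg _) hprow hpcol (fun i j => Complex.normSq (N i j))
    (fun _ _ => Complex.normSq_nonneg _) hrow
    (fun i j h => by simp [htri i j h]) hpw
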